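/- Every factor of a Sturmian word has exactly two or three abelian returns. -/

import Mathlib

/-- The factor of length `n` of the infinite word `w` starting at position `i`. -/
def wordAt {α : Type*} (w : ℕ → α) (i n : ℕ) : List α :=
  (List.range n).map (fun k => w (i + k))

/-- `u` is a factor of the infinite word `w`. -/
def IsFactorW {α : Type*} (w : ℕ → α) (u : List α) : Prop :=
  ∃ i, u = wordAt w i u.length

/-- `w` is recurrent: every factor occurs infinitely often. -/
def RecurrentW {α : Type*} (w : ℕ → α) : Prop :=
  ∀ u, IsFactorW w u → ∀ N, ∃ i, N ≤ i ∧ u = wordAt w i u.length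

/-- `w` is (purely) periodic. -/
def PeriodicW {α : Type*} (w : ℕ → α) : Prop :=
  ∃ T, 0 < T ∧ ∀ n, w (n + T) = w n

/-- `w` is ultimately periodic. -/
def UltPeriodicW {α : Type*} (w : ℕ → α) : Prop :=
  ∃ T, 0 < T ∧ ∃ n₀, ∀ n, n₀ ≤ n → w (n + T) = w n

/-- Two finite words are abelian equivalent: same number of occurrences of each letter. -/
def AbEquiv {α : Type*} [DecidableEq α] (u v : List α) : Prop :=
  ∀ a : α, u.count a = v.count a

/-- Positions of occurrences of words abelian equivalent to `u` in `w`. -/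
def abOcc {α : Type*} [DecidableEq α] (w : ℕ → α) (u : List α) : Set ℕ :=
  {i | AbEquiv (wordAt w i u.length) u}

/-- The semi-abelian returns to (the abelian class of) `u` in `w`: words extending from one
occurrence of the abelian class of `u` to the next one. -/
def semiAbReturns {α : Type*} [DecidableEq α] (w : ℕ → α) (u : List α) : Set (List α) :=
  {r | ∃ i j, i ∈ abOcc w u ∧ j ∈ abOcc w u ∧ i < j ∧
      (∀ k, i < k → k < j → k ∉ abOcc w u) ∧ r = wordAt w i (j - i)}

/-- Positions of (exact) occurrences of `u` in `w`. -/
def occW {α : Type*} [DecidableEq α] (w : ℕ → α) (u : List α) : Set ℕ :=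
  {i | u = wordAt w i u.length}

/-- The ordinary return words of `u` in `w`. -/
def returnWords {α : Type*} [DecidableEq α] (w : ℕ → α) (u : List α) : Set (List α) :=
  {r | ∃ i j, i ∈ occW w u ∧ j ∈ occW w u ∧ i < j ∧
      (∀ k, i < k → k < j → k ∉ occW w u) ∧ r = wordAt w i (j - i)}

/-- `u` has exactly `k` semi-abelian returns in `w`. -/
def ExactlyKSemiAbReturns {α : Type*} [DecidableEq α] (w : ℕ → α) (u : List α) (k : ℕ) : Prop :=
  ∃ f : Fin k → List α, Function.Injective f ∧ semiAbReturns w u = Set.range f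

/-- `u` has exactly `k` abelian returns in `w`: there are `k` pairwise non-abelian-equivalent
representatives so that every semi-abelian return is abelian equivalent to exactly one of them,
and each representative is realized. -/
def ExactlyKAbReturns {α : Type*} [DecidableEq α] (w : ℕ → α) (u : List α) (k : ℕ) : Prop :=
  ∃ f : Fin k → List α,
    (∀ i j, AbEquiv (f i) (f j) → i = j) ∧
    (∀ r ∈ semiAbReturns w u, ∃ i, AbEquiv r (f i)) ∧
    (∀ i, ∃ r ∈ semiAbReturns w u, AbEquiv r (f i))

/-- `u` has at most `k` abelian returns in `w`. -/
def AtMostKAbReturns {α : Type*} [DecidableEq α] (w : ℕ → α) (u : List α) (k : ℕ) : Prop :=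
  ∃ f : Fin k → List α, ∀ r ∈ semiAbReturns w u, ∃ i, AbEquiv r (f i)

/-- `u` has at least `k` abelian returns in `w`. -/
def AtLeastKAbReturns {α : Type*} [DecidableEq α] (w : ℕ → α) (u : List α) (k : ℕ) : Prop :=
  ∃ f : Fin k → List α,
    (∀ i j, AbEquiv (f i) (f j) → i = j) ∧
    (∀ i, ∃ r ∈ semiAbReturns w u, AbEquiv r (f i))

/-- `u` has at least two semi-abelian returns in `w`. -/
def AtLeastTwoSemiAbReturns {α : Type*} [DecidableEq α] (w : ℕ → α) (u : List α) : Prop :=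
  ∃ r₁ r₂, r₁ ∈ semiAbReturns w u ∧ r₂ ∈ semiAbReturns w u ∧ r₁ ≠ r₂

/-- The factor complexity of `w`. -/
noncomputable def complexityW {α : Type*} (w : ℕ → α) (n : ℕ) : ℕ :=
  {u : List α | u.length = n ∧ IsFactorW w u}.ncard

/-- A Sturmian word: aperiodic binary word with factor complexity `n + 1`. -/
def SturmianW (w : ℕ → Bool) : Prop :=
  ¬ UltPeriodicW w ∧ ∀ n, complexityW w n = n + 1

/-- Right special factor of a binary word. -/
def RightSpecial (w : ℕ → Bool) (B : List Bool) : Prop :=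
  IsFactorW w (B ++ [false]) ∧ IsFactorW w (B ++ [true])

/-- Left special factor of a binary word. -/
def LeftSpecial (w : ℕ → Bool) (B : List Bool) : Prop :=
  IsFactorW w (false :: B) ∧ IsFactorW w (true :: B)

/-- Bispecial factor of a binary word. -/
def Bispecial (w : ℕ → Bool) (B : List Bool) : Prop :=
  RightSpecial w B ∧ LeftSpecial w B

/-- `w` is `c`-balanced. -/
def CBalanced {α : Type*} [DecidableEq α] (w : ℕ → α) (c : ℕ) : Prop :=
  ∀ u v : List α, IsFactorW w u → IsFactorW w v → u.length = v.length →
    ∀ a : α, |((u.count a : ℤ) - (v.count a : ℤ))| ≤ (c : ℤ)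

/-- Prefix sums of a binary word: the number of letters `true` before position `i`. -/
def prefixSum (w : ℕ → Bool) (i : ℕ) : ℤ :=
  ∑ k ∈ Finset.range i, if w k then 1 else 0

lemma prefixSum_succ (w : ℕ → Bool) (i : ℕ) :
    prefixSum w (i + 1) = prefixSum w i + if w i then 1 else 0 :=
  Finset.sum_range_succ _ _

lemma wordAt_length {α : Type*} (w : ℕ → α) (i n : ℕ) : (wordAt w i n).length = n := by
  simp [wordAt]

lemma wordAt_succ {α : Type*} (w : ℕ → α) (i n : ℕ) :
    wordAt w i (n + 1) = wordAt w i n ++ [w (i + n)] := by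
  simp [wordAt, List.range_succ]

lemma wordAt_eq_iff {α : Type*} (w : ℕ → α) (i j n : ℕ) :
    wordAt w i n = wordAt w j n ↔ ∀ k < n, w (i + k) = w (j + k) := by
  simp [wordAt]

lemma isFactorW_wordAt {α : Type*} (w : ℕ → α) (i n : ℕ) : IsFactorW w (wordAt w i n) :=
  ⟨i, by rw [wordAt_length]⟩

lemma count_true_wordAt (w : ℕ → Bool) (i n : ℕ) :
    ((wordAt w i n).count true : ℤ) = prefixSum w (i + n) - prefixSum w i := by
  induction n with
  | zero => simp [wordAt]
  | succ n ih =>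
    rw [wordAt_succ, List.count_append, ← add_assoc, prefixSum_succ]
    push_cast
    rw [ih]
    cases w (i + n) <;> simp
    ring

lemma abEquiv_iff (u v : List Bool) :
    AbEquiv u v ↔ u.length = v.length ∧ u.count true = v.count true := by
  have hu := List.count_true_add_count_false u
  have hv := List.count_true_add_count_false v
  constructor
  · intro h
    have h1 := h true
    have h2 := h false
    omega
  · rintro ⟨h1, h2⟩ (_ | _) <;> omega

lemma factors_eq_range {α : Type*} (w : ℕ → α) (n : ℕ) :
    {u : List α | u.length = n ∧ IsFactorW w u} = Set.range fun i => wordAt w i n := by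
  ext u
  constructor
  · rintro ⟨rfl, i, hi⟩
    exact ⟨i, hi.symm⟩
  · rintro ⟨i, rfl⟩
    exact ⟨wordAt_length _ _ _, isFactorW_wordAt _ _ _⟩

section Balance

variable {w : ℕ → Bool}

lemma ncard_range_wordAt (h : ∀ n, complexityW w n = n + 1) (n : ℕ) :
    (Set.range fun i => wordAt w i n).ncard = n + 1 := by
  rw [← factors_eq_range]
  exact h n

lemma finite_range_wordAt (h : ∀ n, complexityW w n = n + 1) (n : ℕ) :
    (Set.range fun i => wordAt w i n).Finite :=
  Set.finite_of_ncard_ne_zero (by rw [ncard_range_wordAt h]; omega)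

/-- Two positions carrying the same factor of length `n` followed by different letters. -/
def Branch (w : ℕ → Bool) (n i j : ℕ) : Prop :=
  wordAt w i n = wordAt w j n ∧ w (i + n) ≠ w (j + n)

lemma Branch.wordAt_eq (h : ∀ n, complexityW w n = n + 1) {n i j i' j' : ℕ}
    (h₁ : Branch w n i j) (h₂ : Branch w n i' j') : wordAt w i n = wordAt w i' n := by
  by_contra hne
  set F := Set.range fun i => wordAt w i n with hF
  set G := Set.range fun i => wordAt w i (n + 1) with hG
  have hFG : List.dropLast '' (G \ {wordAt w i (n + 1), wordAt w i' (n + 1)}) = F := by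
    ext x
    constructor
    · rintro ⟨_, ⟨⟨k, rfl⟩, -⟩, rfl⟩
      exact ⟨k, by simp [wordAt_succ]⟩
    · rintro ⟨k, rfl⟩
      have key : ∀ l, wordAt w l n = wordAt w k n →
          wordAt w l (n + 1) ≠ wordAt w i (n + 1) → wordAt w l (n + 1) ≠ wordAt w i' (n + 1) →
          wordAt w k n ∈ List.dropLast '' (G \ {wordAt w i (n + 1), wordAt w i' (n + 1)}) :=
        fun l hl h1 h2 => ⟨wordAt w l (n + 1), ⟨⟨l, rfl⟩, by simp [h1, h2]⟩,
          by simp [wordAt_succ, hl]⟩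
      by_cases hk : wordAt w k n = wordAt w i n
      · refine key j (by rw [hk, h₁.1]) ?_ ?_
        · simpa [wordAt_succ, h₁.1] using h₁.2.symm
        · simp [wordAt_succ, ← h₁.1, hne]
      · by_cases hk' : wordAt w k n = wordAt w i' n
        · refine key j' (by rw [hk', h₂.1]) ?_ ?_
          · simp [wordAt_succ, ← h₂.1, Ne.symm hne]
          · simpa [wordAt_succ, h₂.1] using h₂.2.symm
        · refine key k rfl ?_ ?_ <;> simp [wordAt_succ, hk, hk']
  have hGfin : G.Finite := finite_range_wordAt h (n + 1)
  have h1 : F.ncard ≤ (G \ {wordAt w i (n + 1), wordAt w i' (n + 1)}).ncard := by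
    rw [← hFG]
    exact Set.ncard_image_le (hGfin.subset Set.sdiff_subset)
  have hsub : ({wordAt w i (n + 1), wordAt w i' (n + 1)} : Set (List Bool)) ⊆ G := by
    rintro x (rfl | rfl)
    exacts [⟨i, rfl⟩, ⟨i', rfl⟩]
  have h2 := Set.ncard_sdiff_add_ncard_of_subset hsub hGfin
  rw [Set.ncard_pair (by simp [wordAt_succ, hne])] at h2
  have h3 : F.ncard = n + 1 := ncard_range_wordAt h n
  have h4 : G.ncard = n + 1 + 1 := ncard_range_wordAt h (n + 1)
  omega

lemma exists_branch (h : ∀ n, complexityW w n = n + 1) (n : ℕ) : ∃ i j, Branch w n i j := by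
  by_contra! hno
  have hinj : Set.InjOn List.dropLast (Set.range fun i => wordAt w i (n + 1)) := by
    rintro _ ⟨i, rfl⟩ _ ⟨j, rfl⟩ hij
    simp only [wordAt_succ, List.dropLast_concat] at hij ⊢
    have := hno i j
    simp only [Branch, hij, true_and, not_not] at this
    rw [hij, this]
  have himg : List.dropLast '' (Set.range fun i => wordAt w i (n + 1)) =
      Set.range fun i => wordAt w i n := by
    rw [← Set.range_comp]
    congr 1
    ext1 i
    simp [wordAt_succ]
  have h1 := hinj.ncard_image
  rw [himg, ncard_range_wordAt h, ncard_range_wordAt h] at h1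
  omega

/-- A Sturmian word has no factors `b c b`, `a c a` with `c` a palindrome and `a ≠ b`. -/
lemma SturmianW.no_palindrome_pair (hw : SturmianW w) (n i j : ℕ) (hij : w i ≠ w j)
    (hmid : ∀ l, 1 ≤ l → l ≤ n → w (i + l) = w (j + l))
    (hpal : ∀ l, 1 ≤ l → l ≤ n → w (i + l) = w (i + (n + 1 - l)))
    (hi : w (i + (n + 1)) = w i) (hj : w (j + (n + 1)) = w j) : False := by
  obtain ⟨hper, hc⟩ := hw
  have hB : Branch w n (i + 1) (j + 1) := by
    refine ⟨(wordAt_eq_iff _ _ _ _).2 fun k hk => ?_, ?_⟩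
    · simpa [add_assoc, add_comm 1] using hmid (k + 1) (by omega) (by omega)
    · rw [add_assoc, add_assoc, add_comm 1, hi, hj]
      exact hij
  obtain ⟨r, r', hr⟩ := exists_branch hc (n + 1)
  have hr1 : Branch w n (r + 1) (r' + 1) := by
    refine ⟨(wordAt_eq_iff _ _ _ _).2 fun k hk => ?_, ?_⟩
    · simpa [add_assoc, add_comm 1] using (wordAt_eq_iff _ _ _ _).1 hr.1 (k + 1) (by omega)
    · simpa [add_assoc, add_comm 1] using hr.2
  have hrw := (wordAt_eq_iff _ _ _ _).1 (hB.wordAt_eq hc hr1)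
  -- a starting position `p` of the factor `b c b` where `b c` is not right special
  obtain ⟨p, hp, hpn, hpp, hpr⟩ : ∃ p, w p ≠ w r ∧ w (p + (n + 1)) = w p ∧
      (∀ l, 1 ≤ l → l ≤ n → w (p + l) = w (p + (n + 1 - l))) ∧
      ∀ l, 1 ≤ l → l ≤ n → w (r + l) = w (p + l) := by
    have hri : ∀ l, 1 ≤ l → l ≤ n → w (r + l) = w (i + l) := fun l h1 h2 => by
      have := hrw (l - 1) (by omega)
      rw [show i + 1 + (l - 1) = i + l by omega, show r + 1 + (l - 1) = r + l by omega] at this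
      exact this.symm
    by_cases h : w i = w r
    · refine ⟨j, fun h' => hij (h.trans h'.symm), hj, fun l h1 h2 => ?_, fun l h1 h2 => ?_⟩
      · rw [← hmid l h1 h2, ← hmid _ (by omega) (by omega), hpal l h1 h2]
      · rw [hri l h1 h2, hmid l h1 h2]
    · exact ⟨i, h, hi, hpal, hri⟩
  have hwin : ∀ l ≤ n + 1, wordAt w (p + l) (n + 1) ≠ wordAt w r (n + 1) := by
    intro l hl heq
    rw [wordAt_eq_iff] at heq
    have h0 := heq 0 (by omega)
    rw [add_zero, add_zero] at h0
    rcases Nat.eq_zero_or_pos l with rfl | hl0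
    · exact hp h0
    rcases Nat.eq_or_lt_of_le hl with rfl | hln
    · exact hp (hpn ▸ h0)
    · have h1 := heq (n + 1 - l) (by omega)
      rw [show p + l + (n + 1 - l) = p + (n + 1) by omega, hpn, hpr _ (by omega) (by omega),
        ← hpp l (by omega) (by omega), h0] at h1
      exact hp h1
  have hdet : ∀ a b, wordAt w a (n + 1) ≠ wordAt w r (n + 1) →
      wordAt w a (n + 1) = wordAt w b (n + 1) →
      wordAt w (a + 1) (n + 1) = wordAt w (b + 1) (n + 1) := by
    intro a b ha hab
    by_contra hne
    refine ha (Branch.wordAt_eq hc (j := b) ⟨hab, fun h => hne ?_⟩ hr)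
    rw [wordAt_eq_iff] at hab ⊢
    intro k hk
    rcases Nat.lt_succ_iff_lt_or_eq.1 hk with hk | rfl
    · simpa [add_assoc, add_comm 1] using hab (k + 1) (by omega)
    · simpa [add_assoc, add_comm 1] using h
  obtain ⟨l, hl, l', hl', hne, heq⟩ : ∃ l ∈ Finset.range (n + 2), ∃ l' ∈ Finset.range (n + 2),
      l ≠ l' ∧ wordAt w (p + l) (n + 1) = wordAt w (p + l') (n + 1) := by
    have hfin := finite_range_wordAt hc (n + 1)
    have hcard : (hfin.toFinset.erase (wordAt w r (n + 1))).card < (Finset.range (n + 2)).card := by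
      rw [Finset.card_erase_of_mem (by simp), ← Set.ncard_eq_toFinset_card _ hfin,
        ncard_range_wordAt hc]
      simp
    refine Finset.exists_ne_map_eq_of_card_lt_of_maps_to hcard fun l hl => ?_
    simp only [Finset.coe_erase, Set.Finite.coe_toFinset, Set.mem_sdiff, Set.mem_range,
      exists_apply_eq_apply, Set.mem_singleton_iff, true_and]
    exact hwin l (by simpa [Nat.lt_succ_iff] using hl)
  have main : ∀ l l', l < l' → l' ≤ n + 1 →
      wordAt w (p + l) (n + 1) = wordAt w (p + l') (n + 1) → False := by
    intro l l' hlt hle heq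
    have hall : ∀ k, wordAt w (p + l + k) (n + 1) ≠ wordAt w r (n + 1) ∧
        wordAt w (p + l + k) (n + 1) = wordAt w (p + l' + k) (n + 1) := by
      intro k
      induction k using Nat.strong_induction_on with
      | _ k ih =>
        constructor
        · by_cases hk : k < l' - l
          · rw [add_assoc]
            exact hwin _ (by omega)
          · have := ih (k - (l' - l)) (by omega)
            rw [show p + l' + (k - (l' - l)) = p + l + k by omega] at this
            rw [← this.2]
            exact this.1
        · rcases k with _ | k
          · exact heq
          · exact hdet _ _ (ih k (by omega)).1 (ih k (by omega)).2
    refine hper ⟨l' - l, by omega, p + l, fun m hm => ?_⟩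
    have := (wordAt_eq_iff _ _ _ _).1 (hall (m - (p + l))).2 0 (by omega)
    rw [show p + l + (m - (p + l)) + 0 = m by omega,
      show p + l' + (m - (p + l)) + 0 = m + (l' - l) by omega] at this
    exact this.symm
  simp only [Finset.mem_range] at hl hl'
  rcases Nat.lt_or_gt_of_ne hne with h | h
  · exact main l l' h (by omega) heq
  · exact main l' l h (by omega) heq.symm

/-- Sturmian words are balanced. -/
lemma SturmianW.balanced (hw : SturmianW w) (m i j : ℕ) :
    (prefixSum w (i + m) - prefixSum w i) - (prefixSum w (j + m) - prefixSum w j) ≤ 1 := by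
  induction m using Nat.strong_induction_on generalizing i j with
  | _ m ih =>
    by_contra! hgt
    have hstep : ∀ k, prefixSum w k ≤ prefixSum w (k + 1) ∧
        prefixSum w (k + 1) ≤ prefixSum w k + 1 := fun k => by
      rw [prefixSum_succ]
      split_ifs <;> omega
    have hm : 2 ≤ m := by
      rcases m with _ | _ | m
      · simp at hgt
      · have := hstep i
        have := hstep j
        simp only [zero_add] at hgt
        omega
      · omega
    obtain ⟨n, rfl⟩ : ∃ n, m = n + 2 := ⟨m - 2, by omega⟩
    have hD : ∀ k ≤ n, prefixSum w (i + (k + 1)) - prefixSum w i =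
        prefixSum w (j + (k + 1)) - prefixSum w j + 1 := by
      intro k hk
      have h1 := ih (k + 1) (by omega) i j
      have h2 := ih (n + 2 - (k + 1)) (by omega) (i + (k + 1)) (j + (k + 1))
      rw [show i + (k + 1) + (n + 2 - (k + 1)) = i + (n + 2) by omega,
        show j + (k + 1) + (n + 2 - (k + 1)) = j + (n + 2) by omega] at h2
      omega
    have hmax : prefixSum w (i + (n + 2)) - prefixSum w i =
        prefixSum w (j + (n + 2)) - prefixSum w j + 2 := by
      have h1 := hD n le_rfl
      have h2 := hstep (i + (n + 1))
      have h3 := hstep (j + (n + 1))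
      simp only [add_assoc] at h1 h2 h3 hgt ⊢
      norm_num at h1 h2 h3 hgt ⊢
      omega
    have hlet : ∀ k, prefixSum w (k + 1) = prefixSum w k + 1 ∧ w k = true ∨
        prefixSum w (k + 1) = prefixSum w k ∧ w k = false := fun k => by
      rw [prefixSum_succ]
      cases w k <;> simp
    have hends : w i = true ∧ w j = false := by
      have h1 := hD 0 (by omega)
      have h2 := hlet i
      have h3 := hlet j
      simp only [zero_add] at h1
      grind
    have hends' : w (i + (n + 1)) = true ∧ w (j + (n + 1)) = false := by
      have h1 := hD n le_rfl
      have h2 := hlet (i + (n + 1))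
      have h3 := hlet (j + (n + 1))
      simp only [add_assoc] at h1 h2 h3 hmax ⊢
      norm_num at h1 h2 h3 hmax ⊢
      grind
    have hmid : ∀ l, 1 ≤ l → l ≤ n → w (i + l) = w (j + l) := by
      intro l h1 h2
      obtain ⟨l, rfl⟩ : ∃ k, l = k + 1 := ⟨l - 1, by omega⟩
      have h3 := hD l (by omega)
      have h4 := hD (l + 1) (by omega)
      have h5 := hlet (i + (l + 1))
      have h6 := hlet (j + (l + 1))
      simp only [add_assoc] at h3 h4 h5 h6 ⊢
      grind
    have hpal : ∀ k ≤ n, prefixSum w (i + (k + 1)) - prefixSum w i - 1 =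
        prefixSum w (i + (n + 1)) - prefixSum w (i + (n + 1 - k)) := by
      intro k hk
      have h1 := ih (k + 1) (by omega) i (j + (n + 1 - k))
      have h2 := ih (k + 1) (by omega) (i + (n + 1 - k)) j
      rw [show j + (n + 1 - k) + (k + 1) = j + (n + 2) by omega] at h1
      rw [show i + (n + 1 - k) + (k + 1) = i + (n + 2) by omega] at h2
      have h3 := hD k hk
      have h4 := hD (n - k) (by omega)
      rw [show n - k + 1 = n + 1 - k by omega] at h4
      have h5 := hD n le_rfl
      have h6 := hlet (i + (n + 1))
      have h7 := hlet (j + (n + 1))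
      simp only [add_assoc, hends'.1, hends'.2] at h1 h2 h3 h4 h5 h6 h7 ⊢
      norm_num at h1 h2 h3 h4 h5 h6 h7 hmax ⊢
      omega
    refine hw.no_palindrome_pair n i j (by simp [hends]) hmid (fun l h1 h2 => ?_)
      (by rw [hends.1, hends'.1]) (by rw [hends.2, hends'.2])
    obtain ⟨l, rfl⟩ : ∃ k, l = k + 1 := ⟨l - 1, by omega⟩
    have h3 := hpal l (by omega)
    have h4 := hpal (l + 1) (by omega)
    have h5 := hlet (i + (l + 1))
    have h6 := hlet (i + (n + 1 - (l + 1)))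
    rw [show i + (n + 1 - (l + 1)) + 1 = i + (n + 1 - l) by omega] at h6
    simp only [add_assoc] at h3 h4 h5 h6 ⊢
    rcases h5 with h5 | h5 <;> rcases h6 with h6 | h6 <;>
      first | (exfalso; omega) | rw [h5.2, h6.2]

end Balance

section Slope

variable {w : ℕ → Bool}

/-- A Sturmian word has a slope, up to which its prefix sums vary by at most one. -/
lemma SturmianW.exists_slope (hw : SturmianW w) :
    ∃ α : ℝ, ∀ i j : ℕ, (prefixSum w j - α * j) - (prefixSum w i - α * i) ≤ 1 := by
  set S := prefixSum w with hS
  have hbal := hw.balanced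
  have hlow : ∀ m i k : ℕ, (k : ℤ) * (S (i + m) - S i - 1) ≤ S (k * m) := by
    intro m i k
    induction k with
    | zero => simp [hS, prefixSum]
    | succ k ih =>
      have := hbal m i (k * m)
      rw [Nat.succ_mul]
      push_cast
      linarith
  have hup : ∀ m i k : ℕ, S (k * m) ≤ (k : ℤ) * (S (i + m) - S i + 1) := by
    intro m i k
    induction k with
    | zero => simp [hS, prefixSum]
    | succ k ih =>
      have := hbal m (k * m) i
      rw [Nat.succ_mul]
      push_cast
      linarith
  have hcmp : ∀ (m i : ℕ) (m' i' : ℕ), 0 < m → 0 < m' →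
      ((S (i + m) - S i - 1 : ℤ) : ℝ) / m ≤ ((S (i' + m') - S i' + 1 : ℤ) : ℝ) / m' := by
    intro m i m' i' hm hm'
    have h1 := hlow m i m'
    have h2 := hup m' i' m
    rw [mul_comm m m'] at h2
    have h3 := h1.trans h2
    rw [div_le_div_iff₀ (by positivity) (by positivity)]
    have h4 : ((m' * (S (i + m) - S i - 1) : ℤ) : ℝ) ≤ (m * (S (i' + m') - S i' + 1) : ℤ) := by
      exact_mod_cast h3
    push_cast at h4 ⊢
    linarith
  set A : Set ℝ := {x | ∃ m i : ℕ, 0 < m ∧ x = ((S (i + m) - S i - 1 : ℤ) : ℝ) / m} with hA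
  have hne : A.Nonempty := ⟨_, 1, 0, one_pos, rfl⟩
  have hbdd : BddAbove A := by
    refine ⟨((S (0 + 1) - S 0 + 1 : ℤ) : ℝ) / (1 : ℕ), ?_⟩
    rintro _ ⟨m, i, hm, rfl⟩
    exact hcmp m i 1 0 hm one_pos
  have hge : ∀ m i : ℕ, 0 < m → ((S (i + m) - S i - 1 : ℤ) : ℝ) ≤ sSup A * m := by
    intro m i hm
    rw [← div_le_iff₀ (by positivity)]
    exact le_csSup hbdd ⟨m, i, hm, rfl⟩
  have hle : ∀ m i : ℕ, 0 < m → sSup A * m ≤ ((S (i + m) - S i + 1 : ℤ) : ℝ) := by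
    intro m i hm
    rw [← le_div_iff₀ (by positivity)]
    refine csSup_le hne ?_
    rintro _ ⟨m', i', hm', rfl⟩
    exact hcmp m' i' m i hm' hm
  refine ⟨sSup A, fun i j => ?_⟩
  rcases lt_trichotomy i j with h | rfl | h
  · obtain ⟨m, rfl⟩ := Nat.exists_eq_add_of_lt h
    have := hge (m + 1) i (by omega)
    rw [← add_assoc] at this
    push_cast at this ⊢
    linarith
  · simp
  · obtain ⟨m, rfl⟩ := Nat.exists_eq_add_of_lt h
    have := hle (m + 1) j (by omega)
    rw [← add_assoc] at this
    push_cast at this ⊢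
    linarith

lemma prefixSum_shift_const (n N : ℕ)
    (h : ∀ i ≥ N, prefixSum w (i + 1 + n) - prefixSum w (i + 1) =
      prefixSum w (i + n) - prefixSum w i) (i : ℕ) (hi : N ≤ i) : w (i + n) = w i := by
  have h1 := h i hi
  rw [show i + 1 + n = i + n + 1 by omega, prefixSum_succ, prefixSum_succ] at h1
  cases h2 : w (i + n) <;> cases h3 : w i <;> simp [h2, h3] at h1 ⊢

/-- A monotone bounded sequence of integers is eventually constant. -/
lemma exists_forall_ge_eq_of_monotone {f : ℕ → ℤ} (hf : Monotone f) (B : ℤ)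
    (hB : ∀ n, f n ≤ B) : ∃ N, ∀ n ≥ N, f n = f N := by
  obtain ⟨_, ⟨N, rfl⟩, hmax⟩ := Int.exists_greatest_of_bdd (P := fun z => ∃ n, f n = z)
    ⟨B, by rintro _ ⟨n, rfl⟩; exact hB n⟩ ⟨f 0, 0, rfl⟩
  exact ⟨N, fun n hn => le_antisymm (hmax _ ⟨n, rfl⟩) (hf hn)⟩

lemma SturmianW.irrational_slope (hw : SturmianW w) {α : ℝ}
    (hα : ∀ i j : ℕ, (prefixSum w j - α * j) - (prefixSum w i - α * i) ≤ 1) : Irrational α := by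
  rintro ⟨x, rfl⟩
  have hq : 0 < x.den := x.den_pos
  have hxq : (x : ℝ) * x.den = x.num := by exact_mod_cast Rat.mul_den_eq_num x
  set q := x.den
  set y : ℕ → ℤ := fun i => prefixSum w (i + q) - prefixSum w i - x.num with hy
  have hsum : ∀ N : ℕ, ((∑ i ∈ Finset.range N, y i : ℤ) : ℝ) =
      ∑ k ∈ Finset.range q, ((prefixSum w (N + k) - x * (N + k : ℕ)) -
        (prefixSum w k - x * k) : ℝ) := by
    intro N
    induction N with
    | zero => simp
    | succ N ih =>
      rw [Finset.sum_range_succ, Int.cast_add, ih]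
      have h1 := Finset.sum_range_succ' (fun k => ((prefixSum w (N + k) : ℝ) - x * (N + k : ℕ))) q
      rw [Finset.sum_range_succ] at h1
      simp only [show ∀ k, N + 1 + k = N + (k + 1) by intro k; omega, Finset.sum_sub_distrib] at h1 ⊢
      have h2 : ((y N : ℤ) : ℝ) = (prefixSum w (N + q) - x * (N + q : ℕ)) -
          (prefixSum w (N + 0) - x * (N + 0 : ℕ)) := by
        simp only [hy]
        push_cast
        rw [add_zero, ← hxq]
        ring
      linarith
  have hbound : ∀ N, |∑ i ∈ Finset.range N, y i| ≤ q := by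
    intro N
    have : |((∑ i ∈ Finset.range N, y i : ℤ) : ℝ)| ≤ q := by
      rw [hsum]
      refine (Finset.abs_sum_le_sum_abs _ _).trans ?_
      refine (Finset.sum_le_card_nsmul _ _ 1 fun k _ => ?_).trans (by simp)
      rw [abs_le]
      have h1 := hα k (N + k)
      have h2 := hα (N + k) k
      constructor <;> linarith
    exact_mod_cast this
  have hconst : ∀ (g : ℕ → ℤ), (∀ i, 0 ≤ g i) → (∀ N, ∑ i ∈ Finset.range N, g i ≤ q) →
      ∃ N, ∀ i ≥ N, g i = 0 := by
    intro g hg hgq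
    obtain ⟨N, hN⟩ := exists_forall_ge_eq_of_monotone
      (f := fun N => ∑ i ∈ Finset.range N, g i)
      (monotone_nat_of_le_succ fun n => by rw [Finset.sum_range_succ]; linarith [hg n]) q hgq
    refine ⟨N, fun i hi => ?_⟩
    have h1 := hN i hi
    have h2 := hN (i + 1) (by omega)
    simp only [Finset.sum_range_succ] at h1 h2
    linarith
  have hyz : ∃ N, ∀ i ≥ N, y i = 0 := by
    by_cases hpos : ∃ i, 0 < y i
    · obtain ⟨i, hi⟩ := hpos
      refine hconst y (fun j => ?_) fun N => (abs_le.1 (hbound N)).2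
      have := hw.balanced q i j
      simp only [hy] at hi ⊢
      omega
    · push Not at hpos
      obtain ⟨N, hN⟩ := hconst (fun i => -y i) (fun i => by linarith [hpos i]) fun N => by
        rw [Finset.sum_neg_distrib]
        linarith [(abs_le.1 (hbound N)).1]
      exact ⟨N, fun i hi => by linarith [hN i hi]⟩
  obtain ⟨N, hN⟩ := hyz
  refine hw.1 ⟨q, hq, N, prefixSum_shift_const q N fun i hi => ?_⟩
  have h1 := hN i hi
  have h2 := hN (i + 1) (by omega)
  simp only [hy] at h1 h2
  omega

end Slope

section Returns

/-- The pairs (length, increment) of the returns of a sequence `s` to the set of positions `i`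
with `s (i + n) - s i = v`. -/
def returnClasses (s : ℕ → ℤ) (n : ℕ) (v : ℤ) : Set (ℕ × ℤ) :=
  {p | ∃ i j, s (i + n) - s i = v ∧ s (j + n) - s j = v ∧ i < j ∧
    (∀ k, i < k → k < j → s (k + n) - s k ≠ v) ∧ p = (j - i, s j - s i)}

lemma returnClasses_neg (s : ℕ → ℤ) (n : ℕ) (v : ℤ) :
    returnClasses (fun i => -s i) n (-v) = Prod.map id Neg.neg '' returnClasses s n v := by
  have h : ∀ i, -s (i + n) - -s i = -v ↔ s (i + n) - s i = v := fun i => by omega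
  ext p
  simp only [returnClasses, Set.mem_ofPred_eq, Set.mem_image, ne_eq, h]
  constructor
  · rintro ⟨i, j, h1, h2, h3, h4, rfl⟩
    exact ⟨_, ⟨i, j, h1, h2, h3, h4, rfl⟩, by simp; ring⟩
  · rintro ⟨_, ⟨i, j, h1, h2, h3, h4, rfl⟩, rfl⟩
    exact ⟨i, j, h1, h2, h3, h4, by simp; ring⟩

variable {α : ℝ}

lemma Irrational.int_sub_mul_ne (hα : Irrational α) {r : ℕ} (hr : 0 < r) (t t' : ℤ) :
    (t : ℝ) - α * r ≠ t' := by
  have := (hα.mul_natCast hr.ne').ne_int (t - t')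
  push_cast at this
  intro h
  exact this (by linarith)

/-- Multiples of an irrational number come arbitrarily close to the integers, from both sides. -/
lemma Irrational.exists_small (hα : Irrational α) {ε : ℝ} (hε : 0 < ε) :
    (∃ r : ℕ, 0 < r ∧ ∃ t : ℤ, 0 < (t : ℝ) - α * r ∧ (t : ℝ) - α * r < ε) ∧
    ∃ r : ℕ, 0 < r ∧ ∃ t : ℤ, (t : ℝ) - α * r < 0 ∧ -ε < (t : ℝ) - α * r := by
  -- from a small displacement one gets a small displacement of the opposite sign
  have step : ∀ {β δ : ℝ} {r : ℕ} {t : ℤ}, Irrational β → 0 < r → 0 < (t : ℝ) - β * r →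
      (t : ℝ) - β * r < δ →
      ∃ r' : ℕ, 0 < r' ∧ ∃ t' : ℤ, (t' : ℝ) - β * r' < 0 ∧ -δ < (t' : ℝ) - β * r' := by
    intro β δ r t hβ hr hd hδ
    by_cases h1 : (t : ℝ) - β * r < 1
    · set d := (t : ℝ) - β * r with hd'
      obtain ⟨k, hk⟩ : ∃ k : ℕ, k = ⌊1 / d⌋₊ := ⟨_, rfl⟩
      have hk1 : 1 ≤ k := by
        rw [hk, Nat.one_le_floor_iff, le_div_iff₀ hd]
        linarith
      have hk2 : (k : ℝ) * d ≤ 1 := by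
        rw [← le_div_iff₀ hd, hk]
        exact Nat.floor_le (by positivity)
      have hk3 : 1 < (k + 1 : ℝ) * d := by
        rw [← div_lt_iff₀ hd, hk]
        exact Nat.lt_floor_add_one _
      have heq : ((k * t - 1 : ℤ) : ℝ) - β * (k * r : ℕ) = k * d - 1 := by
        rw [hd']
        push_cast
        ring
      have hne := hβ.int_sub_mul_ne (Nat.mul_pos hk1 hr) (k * t - 1) 0
      refine ⟨k * r, Nat.mul_pos hk1 hr, k * t - 1, ?_, ?_⟩
      · refine lt_of_le_of_ne ?_ (by exact_mod_cast hne)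
        rw [heq]
        linarith
      · rw [heq]
        linarith
    · refine ⟨1, one_pos, ⌊β⌋, ?_, ?_⟩
      · have h2 := hβ.int_sub_mul_ne one_pos ⌊β⌋ 0
        refine lt_of_le_of_ne ?_ (by exact_mod_cast h2)
        have := Int.floor_le β
        push_cast
        linarith
      · have := Int.lt_floor_add_one β
        push_cast
        linarith
  obtain ⟨n, hn⟩ := exists_nat_one_div_lt hε
  obtain ⟨t, r, hr0, -, h⟩ := Real.exists_int_int_abs_mul_sub_le α (Nat.succ_pos n)
  lift r to ℕ using hr0.le
  have hr : 0 < r := by exact_mod_cast hr0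
  have hlt : |α * r - t| < ε := by
    refine lt_of_le_of_lt ?_ hn
    rw [mul_comm]
    refine h.trans ?_
    push_cast
    gcongr
    linarith
  rw [abs_lt] at hlt
  have hne := hα.int_sub_mul_ne hr t 0
  rw [Int.cast_zero] at hne
  rcases lt_or_gt_of_ne hne with hneg | hpos
  · refine ⟨?_, r, hr, t, hneg, by linarith⟩
    obtain ⟨r', hr', t', h1, h2⟩ := step (t := -t) (δ := ε) hα.neg hr (by push_cast; linarith)
      (by push_cast; linarith)
    exact ⟨r', hr', -t', by push_cast; linarith, by push_cast; linarith⟩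
  · exact ⟨⟨r, hr, t, hpos, by linarith⟩, step hα hr hpos (by linarith)⟩

variable {s : ℕ → ℤ} {c : ℝ}

/-- In a coding of an irrational rotation, the returns to the positions with a given increment
over `n` steps fall into at least two and at most three classes. -/
lemma returnClasses_of_rotation (hα : Irrational α)
    (hlo : ∀ i, c ≤ s i - α * i) (hhi : ∀ i, s i - α * i < c + 1) {n : ℕ} (hn : 0 < n) {v : ℤ}
    (hv : ∃ i, s (i + n) - s i = v)
    (hper : ∀ N, ∃ i ≥ N, s (i + 1 + n) - s (i + 1) ≠ s (i + n) - s i) :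
    (returnClasses s n v).Nontrivial ∧ ∃ p₁ p₂ p₃, returnClasses s n v ⊆ {p₁, p₂, p₃} := by
  set x : ℕ → ℝ := fun i => s i - α * i with hx
  have hxadd : ∀ i r : ℕ, x (i + r) - x i = ((s (i + r) - s i : ℤ) : ℝ) - α * r := by
    intro i r
    simp only [hx]
    push_cast
    ring
  -- positions are determined modulo one
  have hmod : ∀ (i r : ℕ) (t : ℤ), c ≤ x i + (t - α * r) → x i + (t - α * r) < c + 1 →
      s (i + r) - s i = t := by
    intro i r t h1 h2
    have h3 := hxadd i r
    have h4 := hlo (i + r)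
    have h5 := hhi (i + r)
    have h6 : ((s (i + r) - s i - t : ℤ) : ℝ) < (1 : ℤ) := by push_cast at h3 ⊢; linarith
    have h7 : ((-1 : ℤ) : ℝ) < ((s (i + r) - s i - t : ℤ) : ℝ) := by push_cast at h3 ⊢; linarith
    have h8 := Int.cast_lt.1 h6
    have h9 := Int.cast_lt.1 h7
    omega
  set e : ℝ := v - α * n with he
  obtain ⟨i₀, hi₀⟩ := hv
  have he0 : e ≠ 0 := by exact_mod_cast hα.int_sub_mul_ne hn v 0
  set a := max c (c - e) with ha
  set b := min (c + 1) (c + 1 - e) with hb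
  have hbc : b ≤ c + 1 := min_le_left _ _
  have hac : c ≤ a := le_max_left _ _
  have hocc : ∀ i, s (i + n) - s i = v ↔ a ≤ x i ∧ x i < b := by
    intro i
    simp only [ha, hb, max_le_iff, lt_min_iff]
    constructor
    · intro h
      have h1 := hxadd i n
      rw [h] at h1
      have h2 := hlo (i + n)
      have h3 := hhi (i + n)
      exact ⟨⟨hlo i, by linarith⟩, hhi i, by linarith⟩
    · rintro ⟨⟨-, h1⟩, -, h2⟩
      exact hmod i n v (by linarith) (by linarith)
  have hoccadd : ∀ (i r : ℕ) (t : ℤ), a ≤ x i + (t - α * r) → x i + (t - α * r) < b →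
      s (i + r + n) - s (i + r) = v ∧ s (i + r) - s i = t := by
    intro i r t h1 h2
    have h3 := hmod i r t (by linarith) (by linarith)
    have h4 := hxadd i r
    rw [h3] at h4
    refine ⟨(hocc _).2 ⟨by linarith, by linarith⟩, h3⟩
  have hnext : ∀ i, s (i + n) - s i = v → ∃ j, i < j ∧ s (j + n) - s j = v ∧
      ∀ k, i < k → k < j → s (k + n) - s k ≠ v := by
    intro i hi
    have hex : ∃ j, i < j ∧ s (j + n) - s j = v := by
      by_contra! hno
      obtain ⟨k, hk, hne⟩ := hper (i + 1)
      have hclose : ∀ j, |s (j + n) - s j - v| < 2 := by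
        intro j
        have h1 := hxadd j n
        have h2 := hxadd i n
        rw [hi] at h2
        have := hlo j
        have := hhi j
        have := hlo i
        have := hhi i
        have := hlo (j + n)
        have := hhi (j + n)
        have := hlo (i + n)
        have := hhi (i + n)
        have h3 : |((s (j + n) - s j - v : ℤ) : ℝ)| < 2 := by
          rw [abs_lt]
          push_cast at h1 h2 ⊢
          constructor <;> linarith
        exact_mod_cast h3
      have hclose' : |(s (k + 1 + n) - s (k + 1)) - (s (k + n) - s k)| < 2 := by
        have h1 := hxadd k n
        have h2 := hxadd (k + 1) n
        have := hlo k
        have := hhi k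
        have := hlo (k + 1)
        have := hhi (k + 1)
        have := hlo (k + n)
        have := hhi (k + n)
        have := hlo (k + 1 + n)
        have := hhi (k + 1 + n)
        have h3 : |(((s (k + 1 + n) - s (k + 1)) - (s (k + n) - s k) : ℤ) : ℝ)| < 2 := by
          rw [abs_lt]
          push_cast at h1 h2 ⊢
          constructor <;> linarith
        exact_mod_cast h3
      have h1 := hclose k
      have h2 := hclose (k + 1)
      have h3 := hno k (by omega)
      have h4 := hno (k + 1) (by omega)
      rw [abs_lt] at h1 h2 hclose'
      omega
    classical
    refine ⟨Nat.find hex, (Nat.find_spec hex).1, (Nat.find_spec hex).2, fun k h1 h2 h3 => ?_⟩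
    exact Nat.find_min hex h2 ⟨h1, h3⟩
  constructor
  · obtain ⟨j₀, hj₀, hj₀v, hj₀k⟩ := hnext i₀ hi₀
    have hmem : (j₀ - i₀, s j₀ - s i₀) ∈ returnClasses s n v :=
      ⟨i₀, j₀, hi₀, hj₀v, hj₀, hj₀k, rfl⟩
    by_contra hnt
    rw [Set.not_nontrivial_iff] at hnt
    obtain ⟨ℓ, hℓ, rfl⟩ : ∃ ℓ, 0 < ℓ ∧ j₀ = i₀ + ℓ := ⟨j₀ - i₀, by omega, by omega⟩
    rw [Nat.add_sub_cancel_left] at hmem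
    set T := s (i₀ + ℓ) - s i₀
    have hiter : ∀ k : ℕ, s (i₀ + k * ℓ + n) - s (i₀ + k * ℓ) = v ∧
        x (i₀ + k * ℓ) = x i₀ + k * (T - α * ℓ) := by
      intro k
      induction k with
      | zero => simpa using hi₀
      | succ k ih =>
        obtain ⟨j, hj, hjv, hjk⟩ := hnext _ ih.1
        have heq := hnt ⟨_, j, ih.1, hjv, hj, hjk, rfl⟩ hmem
        rw [Prod.mk.injEq] at heq
        obtain rfl : j = i₀ + k * ℓ + ℓ := by omega
        rw [Nat.succ_mul, ← add_assoc]
        refine ⟨hjv, ?_⟩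
        have h1 := hxadd (i₀ + k * ℓ) ℓ
        rw [heq.2, ih.2] at h1
        push_cast
        linarith
    have hT : (T : ℝ) - α * ℓ ≠ 0 := by exact_mod_cast hα.int_sub_mul_ne hℓ T 0
    obtain ⟨k, hk⟩ := exists_nat_gt (1 / |(T : ℝ) - α * ℓ|)
    rw [div_lt_iff₀ (abs_pos.2 hT), ← Nat.abs_cast k, ← abs_mul] at hk
    have h1 := (hiter k).2
    have := hlo (i₀ + k * ℓ)
    have := hhi (i₀ + k * ℓ)
    have := hlo i₀
    have := hhi i₀
    have : |(k : ℝ) * (T - α * ℓ)| ≤ 1 := by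
      rw [abs_le]
      constructor <;> linarith
    linarith
  · have hab : 0 < b - a := by
      have := (hocc i₀).1 hi₀
      linarith
    have hba : b - a ≤ 1 := by linarith
    obtain ⟨hP, hM⟩ := hα.exists_small hab
    classical
    obtain ⟨m, hm0, t, ht0, ht, hmin⟩ : ∃ m : ℕ, 0 < m ∧ ∃ t : ℤ, 0 < (t : ℝ) - α * m ∧
        (t : ℝ) - α * m < b - a ∧ ∀ (r : ℕ) (z : ℤ), 0 < r → 0 < (z : ℝ) - α * r →
          (z : ℝ) - α * r < b - a → m ≤ r := by
      obtain ⟨h0, t, h1, h2⟩ := Nat.find_spec hP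
      exact ⟨_, h0, t, h1, h2, fun r z hr hz hz' => Nat.find_min' hP ⟨hr, z, hz, hz'⟩⟩
    obtain ⟨m', hm0', t', ht0', ht', hmin'⟩ : ∃ m : ℕ, 0 < m ∧ ∃ t : ℤ, (t : ℝ) - α * m < 0 ∧
        -(b - a) < (t : ℝ) - α * m ∧ ∀ (r : ℕ) (z : ℤ), 0 < r → (z : ℝ) - α * r < 0 →
          -(b - a) < (z : ℝ) - α * r → m ≤ r := by
      obtain ⟨h0, t, h1, h2⟩ := Nat.find_spec hM
      exact ⟨_, h0, t, h1, h2, fun r z hr hz hz' => Nat.find_min' hM ⟨hr, z, hz, hz'⟩⟩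
    have hunit : ∀ z z' : ℤ, (z : ℝ) - z' < 1 → ¬ (0 < (z : ℝ) - z') := by
      intro z z' h1 h2
      have h3 : z < z' + 1 := by exact_mod_cast (by linarith : (z : ℝ) < z' + 1)
      have h4 : z' < z := by exact_mod_cast (by linarith : (z' : ℝ) < z)
      omega
    refine ⟨(m, t), (m', t'), (m + m', t + t'), ?_⟩
    rintro _ ⟨i, j, hi, hj, hij, hk, rfl⟩
    obtain ⟨r, hr, rfl⟩ : ∃ r, 0 < r ∧ j = i + r := ⟨j - i, by omega, by omega⟩
    rw [Nat.add_sub_cancel_left]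
    have hfirst : ∀ (r' : ℕ) (z : ℤ), 0 < r' → a ≤ x i + (z - α * r') →
        x i + (z - α * r') < b → r ≤ r' ∧ s (i + r') - s i = z := by
      intro r' z hr' h1 h2
      obtain ⟨h3, h4⟩ := hoccadd i r' z h1 h2
      refine ⟨?_, h4⟩
      by_contra hlt
      exact hk (i + r') (by omega) (by omega) h3
    have hd := hxadd i r
    set T := s (i + r) - s i with hT
    have hd0 : (T : ℝ) - α * r ≠ 0 := by exact_mod_cast hα.int_sub_mul_ne hr T 0
    obtain ⟨hi1, hi2⟩ := (hocc i).1 hi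
    obtain ⟨hj1, hj2⟩ := (hocc _).1 hj
    have hcast : ((t + t' : ℤ) : ℝ) - α * (m + m' : ℕ) = (t - α * m) + (t' - α * m') := by
      push_cast
      ring
    simp only [Set.mem_insert_iff, Set.mem_singleton_iff]
    -- if neither of the two shortest displacements stays inside, their sum does
    have hmiddle : b ≤ x i + (t - α * m) → x i + (t' - α * m') < a → m + m' ≤ r →
        (r, T) = (m + m', t + t') := by
      intro h1 h2 h3
      obtain ⟨h4, h5⟩ := hfirst (m + m') (t + t') (by omega) (by rw [hcast]; linarith)
        (by rw [hcast]; linarith)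
      obtain rfl : r = m + m' := by omega
      rw [hT, h5]
    rcases lt_or_gt_of_ne hd0 with hneg | hpos
    · have hr' := hmin' r T hr hneg (by linarith)
      by_cases hin : a ≤ x i + (t' - α * m')
      · obtain ⟨h1, h2⟩ := hfirst m' t' hm0' hin (by linarith)
        obtain rfl : r = m' := by omega
        exact Or.inr (Or.inl (by rw [hT, h2]))
      · push Not at hin
        have hne : r ≠ m' := by
          rintro rfl
          exact hunit T t' (by linarith) (by linarith)
        have hcast' : ((T - t' : ℤ) : ℝ) - α * (r - m' : ℕ) = (T - α * r) - (t' - α * m') := by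
          rw [Nat.cast_sub hr']
          push_cast
          ring
        have hge := hmin (r - m') (T - t') (by omega) (by rw [hcast']; linarith)
          (by rw [hcast']; linarith)
        refine Or.inr (Or.inr (hmiddle ?_ hin (by omega)))
        by_contra! hlt
        have := (hfirst m t hm0 (by linarith) hlt).1
        omega
    · have hr' := hmin r T hr hpos (by linarith)
      by_cases hin : x i + (t - α * m) < b
      · obtain ⟨h1, h2⟩ := hfirst m t hm0 (by linarith) hin
        obtain rfl : r = m := by omega
        exact Or.inl (by rw [hT, h2])
      · push Not at hin
        have hne : r ≠ m := by
          rintro rfl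
          exact hunit t T (by linarith) (by linarith)
        have hcast' : ((T - t : ℤ) : ℝ) - α * (r - m : ℕ) = (T - α * r) - (t - α * m) := by
          rw [Nat.cast_sub hr']
          push_cast
          ring
        have hge := hmin' (r - m) (T - t) (by omega) (by rw [hcast']; linarith)
          (by rw [hcast']; linarith)
        refine Or.inr (Or.inr (hmiddle hin ?_ (by omega)))
        by_contra! hle
        have := (hfirst m' t' hm0' hle (by linarith)).1
        omega

/-- The returns of a Sturmian word to an abelian class fall into two or three classes. -/
lemma SturmianW.returnClasses_two_or_three {w : ℕ → Bool} (hw : SturmianW w) {n : ℕ} (hn : 0 < n) {v : ℤ}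
    (hv : ∃ i, prefixSum w (i + n) - prefixSum w i = v) :
    (returnClasses (prefixSum w) n v).Nontrivial ∧
      ∃ p₁ p₂ p₃, returnClasses (prefixSum w) n v ⊆ {p₁, p₂, p₃} := by
  obtain ⟨α, hbd⟩ := hw.exists_slope
  have hα := hw.irrational_slope hbd
  have hper : ∀ N, ∃ i ≥ N, prefixSum w (i + 1 + n) - prefixSum w (i + 1) ≠
      prefixSum w (i + n) - prefixSum w i := by
    by_contra! h
    obtain ⟨N, hN⟩ := h
    exact hw.1 ⟨n, hn, N, prefixSum_shift_const n N hN⟩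
  set x : ℕ → ℝ := fun i => prefixSum w i - α * i with hx
  set c := ⨅ i, x i with hc
  have hbdd : BddBelow (Set.range x) := by
    refine ⟨x 0 - 1, ?_⟩
    rintro _ ⟨i, rfl⟩
    linarith [hbd i 0]
  have hlo : ∀ i, c ≤ x i := ciInf_le hbdd
  have hhi : ∀ i, x i ≤ c + 1 := by
    intro i
    have : x i - 1 ≤ c := le_ciInf fun j => by linarith [hbd j i]
    linarith
  by_cases htop : ∃ i, x i = c + 1
  · obtain ⟨i, hi⟩ := htop
    have hbot : ∀ j, x j ≠ c := by
      intro j hj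
      have h1 : x i - x j = 1 := by rw [hi, hj]; ring
      simp only [hx] at h1
      rcases lt_trichotomy i j with h | rfl | h
      · obtain ⟨r, rfl⟩ := Nat.exists_eq_add_of_lt h
        apply hα.int_sub_mul_ne (Nat.succ_pos r) (prefixSum w (i + r + 1) - prefixSum w i) (-1)
        push_cast at h1 ⊢
        linarith
      · simp at h1
      · obtain ⟨r, rfl⟩ := Nat.exists_eq_add_of_lt h
        apply hα.int_sub_mul_ne (Nat.succ_pos r) (prefixSum w (j + r + 1) - prefixSum w j) 1
        push_cast at h1 ⊢
        linarith
    have key := returnClasses_of_rotation (s := fun i => -prefixSum w i) (c := -c - 1) hα.neg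
      (fun i => by have := hhi i; simp only [hx] at this; push_cast; linarith)
      (fun i => by
        have := lt_of_le_of_ne (hlo i) (hbot i).symm
        simp only [hx] at this
        push_cast
        linarith) hn (v := -v) (by obtain ⟨i, hi⟩ := hv; exact ⟨i, by omega⟩)
      (fun N => by obtain ⟨i, hi, h⟩ := hper N; exact ⟨i, hi, by omega⟩)
    rw [returnClasses_neg] at key
    obtain ⟨h1, p₁, p₂, p₃, h2⟩ := key
    have hinv : ∀ p : ℕ × ℤ, Prod.map id Neg.neg (Prod.map id Neg.neg p) = p :=
      fun p => Prod.ext rfl (neg_neg p.2)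
    refine ⟨Set.nontrivial_of_image _ _ h1, Prod.map id Neg.neg p₁,
      Prod.map id Neg.neg p₂, Prod.map id Neg.neg p₃,
      fun p hp => ?_⟩
    have h3 := h2 ⟨p, hp, rfl⟩
    simp only [Set.mem_insert_iff, Set.mem_singleton_iff] at h3 ⊢
    rcases h3 with h3 | h3 | h3 <;> rw [← h3, hinv] <;> simp
  · push Not at htop
    exact returnClasses_of_rotation hα hlo (fun i => lt_of_le_of_ne (hhi i) (htop i)) hn hv hper

end Returns

/-- The number of abelian returns is the number of classes of returns. -/
lemma exactlyKAbReturns_of_ncard {w : ℕ → Bool} {u : List Bool} {k : ℕ} (hk : 0 < k)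
    (h : (returnClasses (prefixSum w) u.length (u.count true)).ncard = k) :
    ExactlyKAbReturns w u k := by
  set C : List Bool → ℕ × ℤ := fun r => (r.length, r.count true) with hC
  have hCiff : ∀ r r', AbEquiv r r' ↔ C r = C r' := fun r r' => by simp [abEquiv_iff, hC]
  have hocc : ∀ i, i ∈ abOcc w u ↔
      prefixSum w (i + u.length) - prefixSum w i = u.count true := fun i => by
    simp only [abOcc, Set.mem_ofPred_eq, abEquiv_iff, wordAt_length, true_and]
    rw [← count_true_wordAt, Nat.cast_inj]
  have himg : returnClasses (prefixSum w) u.length (u.count true) = C '' semiAbReturns w u := by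
    have hCw : ∀ i j, i < j → C (wordAt w i (j - i)) = (j - i, prefixSum w j - prefixSum w i) := by
      intro i j hij
      simp only [hC, wordAt_length, count_true_wordAt, Nat.add_sub_cancel' hij.le]
    ext p
    simp only [returnClasses, semiAbReturns, Set.mem_image, Set.mem_ofPred_eq, hocc]
    constructor
    · rintro ⟨i, j, h1, h2, h3, h4, rfl⟩
      exact ⟨_, ⟨i, j, h1, h2, h3, h4, rfl⟩, hCw i j h3⟩
    · rintro ⟨_, ⟨i, j, h1, h2, h3, h4, rfl⟩, rfl⟩
      exact ⟨i, j, h1, h2, h3, h4, hCw i j h3⟩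
  rw [himg] at h
  have hfin : Finite (C '' semiAbReturns w u) := (Set.finite_of_ncard_ne_zero (by omega)).to_subtype
  have e := Finite.equivFinOfCardEq h
  have hf : ∀ i, ∃ r ∈ semiAbReturns w u, C r = e.symm i := fun i => (e.symm i).2
  choose f hf1 hf2 using hf
  refine ⟨f, fun i j hij => ?_, fun r hr => ⟨e ⟨C r, r, hr, rfl⟩, ?_⟩, fun i => ⟨f i, hf1 i, ?_⟩⟩
  · rw [hCiff, hf2, hf2] at hij
    exact e.symm.injective (Subtype.ext hij)
  · rw [hCiff, hf2, Equiv.symm_apply_apply]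
  · rw [hCiff]

/-- Every factor of a Sturmian word has exactly two or three abelian returns. -/
theorem stmt7 (w : ℕ → Bool) (hst : SturmianW w) (u : List Bool)
    (hu : IsFactorW w u) (hne : u ≠ []) :
    ExactlyKAbReturns w u 2 ∨ ExactlyKAbReturns w u 3 := by
  have hpos : 0 < u.length := List.length_pos_iff.2 hne
  obtain ⟨i, hi⟩ := hu
  obtain ⟨hnt, p₁, p₂, p₃, hsub⟩ := hst.returnClasses_two_or_three hpos (v := u.count true)
    ⟨i, by rw [← count_true_wordAt, ← hi]⟩
  have hfin : ({p₁, p₂, p₃} : Set (ℕ × ℤ)).Finite := by simp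
  have hle := (Set.ncard_le_ncard hsub hfin).trans (Set.ncard_insert_le p₁ {p₂, p₃})
  have hle' := Set.ncard_insert_le p₂ {p₃}
  rw [Set.ncard_singleton] at hle'
  have hlt := (Set.one_lt_ncard_iff_nontrivial_and_finite).2 ⟨hnt, hfin.subset hsub⟩
  rcases (by omega : (returnClasses (prefixSum w) u.length (u.count true)).ncard = 2 ∨
      (returnClasses (prefixSum w) u.length (u.count true)).ncard = 3) with h | h
  · exact Or.inl (exactlyKAbReturns_of_ncard two_pos h)
  · exact Or.inr (exactlyKAbReturns_of_ncard three_pos h)
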